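/- Let A = ℂ[u,v,w]/(uw − v²) with the sl(2)-action induced from the standard action on ℂ² (so that u, v, w span the adjoint-type 3-dimensional representation, with E(w) = 2v, E(v) = u, E(u) = 0, etc.). Then every nonzero sl(2)-invariant ideal I ⊆ A contained in the augmentation ideal is a power of the maximal ideal m = (u,v,w). -/

import Mathlib

open MvPolynomial

/-- A submodule stable under an operator contains each summand of any of its elements that is
written as a sum of eigenvectors with pairwise distinct eigenvalues. -/
theorem mem_of_sum_eigenvectors_mem {K V ι : Type*} [Field K] [AddCommGroup V] [Module K V]
    (T : V →ₗ[K] V) (W : Submodule K V) (hT : ∀ x ∈ W, T x ∈ W) (μ : ι → K) (S : Finset ι)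
    (hμ : Set.InjOn μ S) (f : ι → V) (hf : ∀ i ∈ S, T (f i) = μ i • f i)
    (hS : ∑ i ∈ S, f i ∈ W) : ∀ i ∈ S, f i ∈ W := by
  classical
  induction S using Finset.induction_on generalizing f with
  | empty => simp
  | insert i S hi ih =>
    have hrest : ∀ j ∈ S, f j ∈ W := by
      intro j hj
      have hne : μ j - μ i ≠ 0 := fun h => by
        have hji : j = i := hμ (by simp [hj]) (by simp) (sub_eq_zero.mp h)
        exact hi (hji ▸ hj)
      have hsum : ∑ l ∈ S, (μ l - μ i) • f l ∈ W := by
        have hdiff := W.sub_mem (hT _ hS) (W.smul_mem (μ i) hS)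
        rw [map_sum, Finset.smul_sum, ← Finset.sum_sub_distrib, Finset.sum_insert hi,
          hf i (by simp), sub_self, zero_add] at hdiff
        convert hdiff using 1
        refine Finset.sum_congr rfl fun l hl => ?_
        rw [hf l (by simp [hl]), sub_smul]
      have hscaled := ih (hμ.mono (by simp)) (fun l => (μ l - μ i) • f l)
        (fun l hl => by rw [map_smul, hf l (by simp [hl]), smul_comm]) hsum j hj
      exact (W.smul_mem_iff hne).mp hscaled
    intro j hj
    rcases Finset.mem_insert.mp hj with rfl | hj
    · rw [Finset.sum_insert hi] at hS
      exact (W.add_mem_iff_left (W.sum_mem hrest)).mp hS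
    · exact hrest j hj

/-- For `a + c` even, the element corresponding to the invariant monomial `x ^ a * y ^ c`, where
`u`, `v`, `w` correspond to `x ^ 2`, `x * y`, `y ^ 2`. -/
def evenMonomial {Q : Type*} [CommRing Q] (u v w : Q) (a c : ℕ) : Q :=
  u ^ (a / 2) * v ^ (a % 2) * w ^ (c / 2)

section EvenMonomial

variable {Q : Type*} [CommRing Q] {u v w : Q}

theorem evenMonomial_even (i j : ℕ) : evenMonomial u v w (2 * i) (2 * j) = u ^ i * w ^ j := by
  simp [evenMonomial]

theorem evenMonomial_odd (i j : ℕ) :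
    evenMonomial u v w (2 * i + 1) (2 * j + 1) = u ^ i * v * w ^ j := by
  have h (n : ℕ) : (2 * n + 1) / 2 = n := by omega
  have h' : (2 * i + 1) % 2 = 1 := by omega
  simp [evenMonomial, h, h']

theorem exists_halves_of_even_add {a c : ℕ} (h : Even (a + c)) :
    (∃ i j, a = 2 * i ∧ c = 2 * j) ∨ ∃ i j, a = 2 * i + 1 ∧ c = 2 * j + 1 := by
  obtain ⟨s, hs⟩ := h
  rcases Nat.even_or_odd' a with ⟨i, rfl | rfl⟩
  · exact Or.inl ⟨i, s - i, rfl, by omega⟩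
  · exact Or.inr ⟨i, s - i - 1, rfl, by omega⟩

theorem evenMonomial_mul_u {a c : ℕ} (h : Even (a + c)) :
    evenMonomial u v w a c * u = evenMonomial u v w (a + 2) c := by
  rcases exists_halves_of_even_add h with ⟨i, j, rfl, rfl⟩ | ⟨i, j, rfl, rfl⟩
  · rw [show 2 * i + 2 = 2 * (i + 1) by ring, evenMonomial_even, evenMonomial_even]; ring
  · rw [show 2 * i + 1 + 2 = 2 * (i + 1) + 1 by ring, evenMonomial_odd, evenMonomial_odd]; ring

theorem evenMonomial_mul_w {a c : ℕ} (h : Even (a + c)) :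
    evenMonomial u v w a c * w = evenMonomial u v w a (c + 2) := by
  rcases exists_halves_of_even_add h with ⟨i, j, rfl, rfl⟩ | ⟨i, j, rfl, rfl⟩
  · rw [show 2 * j + 2 = 2 * (j + 1) by ring, evenMonomial_even, evenMonomial_even]; ring
  · rw [show 2 * j + 1 + 2 = 2 * (j + 1) + 1 by ring, evenMonomial_odd, evenMonomial_odd]; ring

theorem evenMonomial_mul_v (huw : u * w = v ^ 2) {a c : ℕ} (h : Even (a + c)) :
    evenMonomial u v w a c * v = evenMonomial u v w (a + 1) (c + 1) := by
  rcases exists_halves_of_even_add h with ⟨i, j, rfl, rfl⟩ | ⟨i, j, rfl, rfl⟩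
  · rw [evenMonomial_even, evenMonomial_odd]; ring
  · rw [show 2 * i + 1 + 1 = 2 * (i + 1) by ring, show 2 * j + 1 + 1 = 2 * (j + 1) by ring,
      evenMonomial_even, evenMonomial_odd]
    linear_combination -(u ^ i * w ^ j) * huw

theorem evenMonomial_mem_pow {a c : ℕ} (h : Even (a + c)) :
    evenMonomial u v w a c ∈ Ideal.span {u, v, w} ^ ((a + c) / 2) := by
  have hu : u ∈ Ideal.span {u, v, w} := Ideal.subset_span (by simp)
  have hv : v ∈ Ideal.span {u, v, w} := Ideal.subset_span (by simp)
  have hw : w ∈ Ideal.span {u, v, w} := Ideal.subset_span (by simp)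
  rcases exists_halves_of_even_add h with ⟨i, j, rfl, rfl⟩ | ⟨i, j, rfl, rfl⟩
  · rw [evenMonomial_even, show (2 * i + 2 * j) / 2 = i + j by omega, pow_add]
    exact Ideal.mul_mem_mul (Ideal.pow_mem_pow hu i) (Ideal.pow_mem_pow hw j)
  · rw [evenMonomial_odd, show (2 * i + 1 + (2 * j + 1)) / 2 = i + 1 + j by omega, pow_add,
      pow_succ]
    exact Ideal.mul_mem_mul (Ideal.mul_mem_mul (Ideal.pow_mem_pow hu i) hv)
      (Ideal.pow_mem_pow hw j)

theorem span_pow_le_of_evenMonomial_mem (huw : u * w = v ^ 2) (k : ℕ) (I : Ideal Q)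
    (hI : ∀ a c, a + c = 2 * k → evenMonomial u v w a c ∈ I) :
    Ideal.span {u, v, w} ^ k ≤ I := by
  induction k generalizing I with
  | zero =>
    have hone := hI 0 0 rfl
    rw [show evenMonomial u v w 0 0 = 1 by simp [evenMonomial]] at hone
    simp [(Ideal.eq_top_iff_one I).mpr hone]
  | succ k ih =>
    have hcolon (x : Q) (hx : x ∈ ({u, v, w} : Set Q)) :
        Ideal.span {u, v, w} ^ k ≤ Submodule.comap (LinearMap.mulRight Q x) I := by
      refine ih _ fun a c hac => ?_
      have hev : Even (a + c) := ⟨k, by omega⟩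
      rw [Submodule.mem_comap, LinearMap.mulRight_apply]
      rcases hx with rfl | rfl | rfl
      · rw [evenMonomial_mul_u hev]; exact hI _ _ (by omega)
      · rw [evenMonomial_mul_v huw hev]; exact hI _ _ (by omega)
      · rw [evenMonomial_mul_w hev]; exact hI _ _ (by omega)
    rw [pow_succ, Ideal.mul_le]
    intro r hr s hs
    induction hs using Submodule.span_induction with
    | mem x hx => exact hcolon x hx hr
    | zero => simp
    | add x y _ _ hx hy => rw [mul_add]; exact I.add_mem hx hy
    | smul t x _ hx => rw [smul_eq_mul, mul_left_comm]; exact I.mul_mem_left t hx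

variable [Algebra ℂ Q] {D : Derivation ℂ Q Q}

theorem raising_evenMonomial (huw : u * w = v ^ 2) (hu : D u = 0) (hv : D v = u)
    (hw : D w = 2 * v) {a c : ℕ} (h : Even (a + (c + 1))) :
    D (evenMonomial u v w a (c + 1)) = ((c : ℂ) + 1) • evenMonomial u v w (a + 1) c := by
  have h2 : algebraMap ℂ Q 2 = 2 := map_ofNat _ 2
  rcases exists_halves_of_even_add h with ⟨i, j, rfl, hj⟩ | ⟨i, j, rfl, hj⟩
  · obtain ⟨j, rfl⟩ : ∃ l, j = l + 1 := ⟨j - 1, by omega⟩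
    obtain rfl : c = 2 * j + 1 := by omega
    rw [hj, evenMonomial_even, evenMonomial_odd]
    simp [Derivation.leibniz, Derivation.leibniz_pow, hu, hw, Algebra.smul_def, h2]
    ring
  · obtain rfl : c = 2 * j := by omega
    rw [evenMonomial_odd, show 2 * i + 1 + 1 = 2 * (i + 1) by ring, evenMonomial_even]
    rcases j with _ | j
    · simp [Derivation.leibniz, Derivation.leibniz_pow, hu, hv]
      ring
    · simp [Derivation.leibniz, Derivation.leibniz_pow, hu, hv, hw, Algebra.smul_def, h2]
      linear_combination (-2 * (j + 1) * u ^ i * w ^ j) * huw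

theorem raising_evenMonomial_zero (hu : D u = 0) {a : ℕ} (h : Even a) :
    D (evenMonomial u v w a 0) = 0 := by
  obtain ⟨i, rfl⟩ := even_iff_exists_two_mul.mp h
  rw [show evenMonomial u v w (2 * i) 0 = u ^ i by simpa using evenMonomial_even i 0]
  simp [Derivation.leibniz_pow, hu]

theorem lowering_evenMonomial (huw : u * w = v ^ 2) (hu : D u = 2 * v) (hv : D v = w)
    (hw : D w = 0) {a c : ℕ} (h : Even (a + 1 + c)) :
    D (evenMonomial u v w (a + 1) c) = ((a : ℂ) + 1) • evenMonomial u v w a (c + 1) := by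
  have h2 : algebraMap ℂ Q 2 = 2 := map_ofNat _ 2
  rcases exists_halves_of_even_add h with ⟨i, j, hi, rfl⟩ | ⟨i, j, hi, rfl⟩
  · obtain ⟨i, rfl⟩ : ∃ l, i = l + 1 := ⟨i - 1, by omega⟩
    obtain rfl : a = 2 * i + 1 := by omega
    rw [hi, evenMonomial_even, evenMonomial_odd]
    simp [Derivation.leibniz, Derivation.leibniz_pow, hu, hw, Algebra.smul_def, h2]
    ring
  · obtain rfl : a = 2 * i := by omega
    rw [evenMonomial_odd, show 2 * j + 1 + 1 = 2 * (j + 1) by ring, evenMonomial_even]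
    rcases i with _ | i
    · simp [Derivation.leibniz, Derivation.leibniz_pow, hv, hw]
      ring
    · simp [Derivation.leibniz, Derivation.leibniz_pow, hu, hv, hw, Algebra.smul_def, h2]
      linear_combination (-2 * (i + 1) * u ^ i * w ^ j) * huw

theorem weight_evenMonomial (hu : D u = 2 * u) (hv : D v = 0) (hw : D w = -(2 * w))
    {a c : ℕ} (h : Even (a + c)) :
    D (evenMonomial u v w a c) = ((a : ℂ) - c) • evenMonomial u v w a c := by
  have h2 : algebraMap ℂ Q 2 = 2 := map_ofNat _ 2
  have hpu (i : ℕ) : D (u ^ i) = 2 * i * u ^ i := by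
    rcases i with _ | i
    · simp
    · simp [Derivation.leibniz_pow, hu]; ring
  have hpw (i : ℕ) : D (w ^ i) = -(2 * i * w ^ i) := by
    rcases i with _ | i
    · simp
    · simp [Derivation.leibniz_pow, hw]; ring
  rcases exists_halves_of_even_add h with ⟨i, j, rfl, rfl⟩ | ⟨i, j, rfl, rfl⟩
  · rw [evenMonomial_even]
    simp [Derivation.leibniz, hpu, hpw, Algebra.smul_def, h2]
    ring
  · rw [evenMonomial_odd]
    simp [Derivation.leibniz, hpu, hpw, hv, Algebra.smul_def, h2]
    ring

/-- With `s = (a + c) / 2`, the operator `F E + H² / 4 + H` acts on the monomial of bidegree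
`(a, c)` by `s ^ 2 + a`, which determines `(a, c)`. -/
theorem separating_operator_evenMonomial (huw : u * w = v ^ 2) {E F H : Derivation ℂ Q Q}
    (hEu : E u = 0) (hEv : E v = u) (hEw : E w = 2 * v)
    (hFu : F u = 2 * v) (hFv : F v = w) (hFw : F w = 0)
    (hHu : H u = 2 * u) (hHv : H v = 0) (hHw : H w = -(2 * w)) {a c : ℕ} (h : Even (a + c)) :
    F (E (evenMonomial u v w a c)) + (1 / 4 : ℂ) • H (H (evenMonomial u v w a c)) +
      H (evenMonomial u v w a c) =
      ((((a + c) / 2) ^ 2 + a : ℕ) : ℂ) • evenMonomial u v w a c := by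
  have hs : (((a + c) / 2 : ℕ) : ℂ) = ((a : ℂ) + c) / 2 := by
    rw [Nat.cast_div h.two_dvd (by norm_num)]; push_cast; rfl
  have hFE : F (E (evenMonomial u v w a c)) =
      ((c : ℂ) * (a + 1)) • evenMonomial u v w a c := by
    rcases c with _ | c
    · rw [raising_evenMonomial_zero hEu (by simpa using h)]; simp
    · rw [raising_evenMonomial huw hEu hEv hEw h, Derivation.map_smul,
        lowering_evenMonomial huw hFu hFv hFw (by rwa [add_right_comm, add_assoc]), smul_smul]
      push_cast; rfl
  rw [hFE, weight_evenMonomial hHu hHv hHw h, Derivation.map_smul, weight_evenMonomial hHu hHv hHw h,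
    smul_smul, smul_smul, ← add_smul, ← add_smul]
  congr 1
  push_cast
  rw [hs]
  ring

theorem injOn_sq_half_add :
    Set.InjOn (fun p : ℕ × ℕ => ((((p.1 + p.2) / 2) ^ 2 + p.1 : ℕ) : ℂ))
      {p | Even (p.1 + p.2)} := by
  rintro ⟨a, c⟩ ⟨s, hs⟩ ⟨a', c'⟩ ⟨s', hs'⟩ h
  have h' := Nat.cast_injective (R := ℂ) h
  simp only at hs hs' h'
  rw [hs, hs', show (s + s) / 2 = s by omega, show (s' + s') / 2 = s' by omega] at h'
  have hss : s = s' := by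
    rcases lt_trichotomy s s' with hlt | heq | hlt
    · nlinarith
    · exact heq
    · nlinarith
  subst hss
  ext <;> simp only <;> omega

theorem span_evenMonomial_eq_top (huw : u * w = v ^ 2) {q : MvPolynomial (Fin 3) ℂ →ₐ[ℂ] Q}
    (hq : Function.Surjective q) (hu : u = q (X 0)) (hv : v = q (X 1)) (hw : w = q (X 2)) :
    Submodule.span ℂ ((fun p : ℕ × ℕ => evenMonomial u v w p.1 p.2) ''
      {p | Even (p.1 + p.2)}) = ⊤ := by
  rw [eq_top_iff]
  rintro x -
  obtain ⟨p, rfl⟩ := hq x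
  induction p using MvPolynomial.induction_on with
  | C t =>
    rw [← MvPolynomial.algebraMap_eq, AlgHom.commutes, Algebra.algebraMap_eq_smul_one]
    exact Submodule.smul_mem _ _ (Submodule.subset_span ⟨(0, 0), by simp, by simp [evenMonomial]⟩)
  | add p r hp hr => rw [map_add]; exact Submodule.add_mem _ hp hr
  | mul_X p n hp =>
    rw [map_mul]
    generalize q p = y at hp
    induction hp using Submodule.span_induction with
    | zero => simp
    | add y z _ _ hy hz => rw [add_mul]; exact Submodule.add_mem _ hy hz
    | smul t y _ hy => rw [smul_mul_assoc]; exact Submodule.smul_mem _ _ hy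
    | mem y hy =>
      obtain ⟨⟨a, c⟩, hac, rfl⟩ := hy
      have hac' : Even (a + c) := hac
      refine Submodule.subset_span ?_
      fin_cases n
      · exact ⟨(a + 2, c), by simpa [add_right_comm] using hac'.add even_two,
          by simp [← hu, evenMonomial_mul_u hac']⟩
      · exact ⟨(a + 1, c + 1), by
          have := hac'.add even_two
          simpa [add_add_add_comm] using this,
          by simp [← hv, evenMonomial_mul_v huw hac']⟩
      · exact ⟨(a, c + 2), by simpa [add_assoc] using hac'.add even_two,
          by simp [← hw, evenMonomial_mul_w hac']⟩

/-- An ideal stable under the raising and lowering derivations contains all monomials of a given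
degree as soon as it contains one of them. -/
theorem evenMonomial_mem_of_mem (huw : u * w = v ^ 2) {E F : Derivation ℂ Q Q}
    (hEu : E u = 0) (hEv : E v = u) (hEw : E w = 2 * v)
    (hFu : F u = 2 * v) (hFv : F v = w) (hFw : F w = 0) {I : Ideal Q}
    (hE : ∀ x ∈ I, E x ∈ I) (hF : ∀ x ∈ I, F x ∈ I) {a c a' c' : ℕ} (h : Even (a + c))
    (heq : a' + c' = a + c) (hmem : evenMonomial u v w a c ∈ I) :
    evenMonomial u v w a' c' ∈ I := by
  have hscale {t : ℂ} (ht : t ≠ 0) {x : Q} (hx : t • x ∈ I) : x ∈ I :=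
    ((I.restrictScalars ℂ).smul_mem_iff ht).mp hx
  have htop : evenMonomial u v w (a + c) 0 ∈ I := by
    clear heq
    induction c generalizing a with
    | zero => exact hmem
    | succ c ih =>
      have hraise := hE _ hmem
      rw [raising_evenMonomial huw hEu hEv hEw h] at hraise
      rw [show a + (c + 1) = a + 1 + c by ring] at h ⊢
      exact ih h (hscale (Nat.cast_add_one_ne_zero c) hraise)
  rw [← heq] at htop h
  clear heq hmem
  induction c' generalizing a' with
  | zero => exact htop
  | succ c' ih =>
    rw [show a' + (c' + 1) = a' + 1 + c' by ring] at htop h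
    have hlower := hF _ (ih h htop)
    rw [lowering_evenMonomial huw hFu hFv hFw h] at hlower
    exact hscale (Nat.cast_add_one_ne_zero a') hlower

end EvenMonomial

/-- Let `A = ℂ[u,v,w]/(uw − v²)` with the `sl(2)`-action by derivations `E, F, H`
induced from the standard action on `ℂ²` (so `E u = 0, E v = u, E w = 2v`,
`F u = 2v, F v = w, F w = 0`, `H u = 2u, H v = 0, H w = −2w`).  Then every nonzero
`sl(2)`-invariant ideal `I ⊆ A` contained in the maximal ideal `m = (u,v,w)` is a
power of `m`. -/
theorem stmt_16
    (Q : Type*) [CommRing Q] [Algebra ℂ Q]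
    (q : MvPolynomial (Fin 3) ℂ →ₐ[ℂ] Q)
    (hq : Function.Surjective q)
    (hker : RingHom.ker q = Ideal.span
      {(X 0 : MvPolynomial (Fin 3) ℂ) * X 2 - X 1 ^ 2})
    (u v w : Q) (hu : u = q (X 0)) (hv : v = q (X 1)) (hw : w = q (X 2))
    (E F H : Derivation ℂ Q Q)
    (hEu : E u = 0) (hEv : E v = u) (hEw : E w = 2 * v)
    (hFu : F u = 2 * v) (hFv : F v = w) (hFw : F w = 0)
    (hHu : H u = 2 * u) (hHv : H v = 0) (hHw : H w = -(2 * w))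
    (m : Ideal Q) (hm : m = Ideal.span {u, v, w})
    (I : Ideal Q)
    (hinv : ∀ a ∈ I, E a ∈ I ∧ F a ∈ I ∧ H a ∈ I)
    (hne : I ≠ ⊥) (hle : I ≤ m) :
    ∃ k : ℕ, 1 ≤ k ∧ I = m ^ k := by
  classical
  subst hm
  have hker_mem (p : MvPolynomial (Fin 3) ℂ) :
      q p = 0 ↔ p ∈ Ideal.span {(X 0 : MvPolynomial (Fin 3) ℂ) * X 2 - X 1 ^ 2} := by
    rw [← hker, RingHom.mem_ker]
  have huw : u * w = v ^ 2 := by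
    have h := (hker_mem _).mpr (Ideal.mem_span_singleton_self _)
    rw [map_sub, map_mul, map_pow, ← hu, ← hv, ← hw] at h
    exact sub_eq_zero.mp h
  have hproper : (1 : Q) ∉ Ideal.span {u, v, w} := by
    intro h
    simp only [Ideal.mem_span_insert, Ideal.mem_span_singleton'] at h
    obtain ⟨r₀, _, ⟨r₁, _, ⟨r₂, rfl⟩, rfl⟩, h⟩ := h
    obtain ⟨p₀, rfl⟩ := hq r₀
    obtain ⟨p₁, rfl⟩ := hq r₁
    obtain ⟨p₂, rfl⟩ := hq r₂
    have hzero : q (1 - (p₀ * X 0 + (p₁ * X 1 + p₂ * X 2))) = 0 := by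
      simp only [map_sub, map_add, map_mul, map_one, ← hu, ← hv, ← hw]
      exact sub_eq_zero.mpr h
    obtain ⟨t, ht⟩ := Ideal.mem_span_singleton'.mp ((hker_mem _).mp hzero)
    simpa using congrArg (MvPolynomial.eval 0) ht
  set e : ℕ × ℕ → Q := fun p => evenMonomial u v w p.1 p.2 with he
  let T : Q →ₗ[ℂ] Q :=
    F.toLinearMap ∘ₗ E.toLinearMap + (1 / 4 : ℂ) • (H.toLinearMap ∘ₗ H.toLinearMap) +
      H.toLinearMap
  have hT (x : Q) : T x = F (E x) + (1 / 4 : ℂ) • H (H x) + H x := rfl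
  have hdecomp (x : Q) (hx : x ∈ I) (J : Ideal Q)
      (hJ : ∀ p : ℕ × ℕ, Even (p.1 + p.2) → e p ∈ I → e p ∈ J) : x ∈ J := by
    have hspan : x ∈ Submodule.span ℂ (e '' {p | Even (p.1 + p.2)}) := by
      rw [span_evenMonomial_eq_top huw hq hu hv hw]; trivial
    obtain ⟨l, hl, rfl⟩ := (Finsupp.mem_span_image_iff_linearCombination ℂ).mp hspan
    rw [Finsupp.mem_supported] at hl
    rw [Finsupp.linearCombination_apply, Finsupp.sum] at hx ⊢
    have hterm := mem_of_sum_eigenvectors_mem T (I.restrictScalars ℂ)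
      (fun y hy => by
        rw [hT]
        exact add_mem (add_mem (hinv _ (hinv y hy).1).2.1
          ((I.restrictScalars ℂ).smul_mem _ (hinv _ (hinv y hy).2.2).2.2)) (hinv y hy).2.2)
      _ l.support (injOn_sq_half_add.mono hl) (fun p => l p • e p)
      (fun p hp => by
        rw [map_smul, hT, he, separating_operator_evenMonomial huw hEu hEv hEw hFu hFv hFw
          hHu hHv hHw (hl hp), smul_comm]) hx
    refine J.sum_mem fun p hp => (J.restrictScalars ℂ).smul_mem _ (hJ p (hl hp) ?_)
    exact ((I.restrictScalars ℂ).smul_mem_iff (Finsupp.mem_support_iff.mp hp)).mp (hterm p hp)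
  have hex : ∃ k, ∃ p : ℕ × ℕ, p.1 + p.2 = 2 * k ∧ e p ∈ I := by
    by_contra! hnone
    refine hne ((Submodule.eq_bot_iff I).mpr fun x hx => ?_)
    refine (Submodule.mem_bot Q).mp (hdecomp x hx ⊥ fun p hp hpI => ?_)
    obtain ⟨k, hk⟩ := hp
    exact absurd hpI (hnone k p (by omega))
  obtain ⟨k, ⟨p, hp, hpI⟩, hmin⟩ : ∃ k, (∃ p : ℕ × ℕ, p.1 + p.2 = 2 * k ∧ e p ∈ I) ∧
      ∀ l, (∃ p : ℕ × ℕ, p.1 + p.2 = 2 * l ∧ e p ∈ I) → k ≤ l :=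
    ⟨Nat.find hex, Nat.find_spec hex, fun _ hl => Nat.find_min' hex hl⟩
  have hpow : Ideal.span {u, v, w} ^ k ≤ I :=
    span_pow_le_of_evenMonomial_mem huw _ I fun a c hac =>
      evenMonomial_mem_of_mem huw hEu hEv hEw hFu hFv hFw (fun x hx => (hinv x hx).1)
        (fun x hx => (hinv x hx).2.1) ⟨k, by omega⟩ (hac.trans hp.symm) hpI
  refine ⟨k, Nat.one_le_iff_ne_zero.mpr fun hzero => hproper (hle (hpow ?_)),
    le_antisymm (fun x hx => hdecomp x hx _ fun r hr hrI => ?_) hpow⟩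
  · simp [hzero]
  · exact Ideal.pow_le_pow_right
      (hmin _ ⟨r, (Nat.two_mul_div_two_of_even hr).symm, hrI⟩) (evenMonomial_mem_pow hr)
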